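/- arXiv:1303.1647 — 6 statements merged into one kernel-verified Lean document; each statement's English description precedes it below -/
import Mathlib

section
/- For every γ̄ > 0 and every τ ≥ 0, ∫₀^τ (1/2)·(ln(1+x)/ln 2)·(2/γ̄)·e^{−2x/γ̄} dx = [ e^{2/γ̄} ( E₁(2/γ̄) − E₁(2(1+τ)/γ̄) ) − e^{−2τ/γ̄} ln(1+τ) ] / (2 ln 2). (Appendix B, equation (Ap3): the truncated ergodic-capacity integral of an exponential SNR with density (2/γ̄)e^{−2x/γ̄}.) -/
open MeasureTheory Real

/-- The exponential integral `E₁(z) = ∫₁^∞ e^{-z y}/y dy`. -/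
noncomputable def E1 (z : ℝ) : ℝ := ∫ y in Set.Ioi (1 : ℝ), Real.exp (-z * y) / y

theorem E1_eq_integral_Ioi {z : ℝ} (hz : 0 < z) :
    E1 z = ∫ t in Set.Ioi z, Real.exp (-t) / t := by
  have h := integral_comp_mul_left_Ioi (fun t : ℝ => Real.exp (-t) / t) 1 hz
  rw [mul_one, smul_eq_mul, eq_inv_mul_iff_mul_eq₀ hz.ne', ← integral_const_mul] at h
  rw [← h, E1]
  congr 1
  ext y
  rw [neg_mul]
  field_simp

theorem integrableOn_exp_neg_div_Ioi {z : ℝ} (hz : 0 < z) :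
    IntegrableOn (fun t : ℝ => Real.exp (-t) / t) (Set.Ioi z) := by
  refine ((integrableOn_exp_neg_Ioi z).div_const z).mono'
    (Measurable.aestronglyMeasurable (by fun_prop)) ?_
  refine (ae_restrict_iff' measurableSet_Ioi).2 (ae_of_all _ fun t ht => ?_)
  have ht' : z < t := ht
  have : 0 < t := hz.trans ht'
  rw [Real.norm_of_nonneg (by positivity)]
  gcongr

theorem E1_sub_E1 {a b : ℝ} (ha : 0 < a) (hb : 0 < b) :
    E1 a - E1 b = ∫ t in a..b, Real.exp (-t) / t := by
  rw [E1_eq_integral_Ioi ha, E1_eq_integral_Ioi hb,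
    intervalIntegral.integral_Ioi_sub_Ioi' (integrableOn_exp_neg_div_Ioi ha)
      (integrableOn_exp_neg_div_Ioi hb)]

theorem hasDerivAt_E1 {z : ℝ} (hz : 0 < z) : HasDerivAt E1 (-(Real.exp (-z) / z)) z := by
  have hcont : ∀ t ∈ Set.Ioi (0 : ℝ), ContinuousAt (fun t : ℝ => Real.exp (-t) / t) t :=
    fun t ht => ContinuousAt.div (by fun_prop) continuousAt_id (ne_of_gt ht)
  have h := intervalIntegral.integral_hasDerivAt_right
    (f := fun t : ℝ => Real.exp (-t) / t) (a := z) (b := z) (by simp)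
    (ContinuousAt.stronglyMeasurableAtFilter isOpen_Ioi hcont z hz) (hcont z hz)
  refine (h.const_sub (E1 z)).congr_of_eventuallyEq ?_
  filter_upwards [lt_mem_nhds hz] with w hw
  rw [← E1_sub_E1 hz hw, sub_sub_cancel]

/-- Appendix B, equation (Ap3): the truncated ergodic-capacity integral of an
exponential SNR with density `(2/γ̄)e^{-2x/γ̄}`. -/
theorem Ap3_eq (γbar τ : ℝ) (hγ : 0 < γbar) (hτ : 0 ≤ τ) :
    (∫ x in (0 : ℝ)..τ,
        (1 / 2) * (Real.log (1 + x) / Real.log 2) * ((2 / γbar) * Real.exp (-2 * x / γbar)))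
      = (Real.exp (2 / γbar) * (E1 (2 / γbar) - E1 (2 * (1 + τ) / γbar))
          - Real.exp (-2 * τ / γbar) * Real.log (1 + τ)) / (2 * Real.log 2) := by
  have hlog : Real.log 2 ≠ 0 := (Real.log_pos one_lt_two).ne'
  have hpos : ∀ x ∈ Set.uIcc 0 τ, 0 < 1 + x := fun x hx => by
    rw [Set.uIcc_of_le hτ] at hx
    linarith [hx.1]
  rw [intervalIntegral.integral_eq_sub_of_hasDerivAt
    (f := fun x => (Real.exp (2 / γbar) * (E1 (2 / γbar) - E1 (2 * (1 + x) / γbar))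
          - Real.exp (-2 * x / γbar) * Real.log (1 + x)) / (2 * Real.log 2))]
  · simp
  · intro x hx
    have hx1 := hpos x hx
    have harg : HasDerivAt (fun x : ℝ => 2 * (1 + x) / γbar) (2 * 1 / γbar) x :=
      (((hasDerivAt_id x).const_add 1).const_mul 2).div_const γbar
    have hE := (hasDerivAt_E1 (z := 2 * (1 + x) / γbar) (by positivity)).comp x harg
    have hexp : HasDerivAt (fun x : ℝ => Real.exp (-2 * x / γbar))
        (Real.exp (-2 * x / γbar) * (-2 * 1 / γbar)) x :=
      (((hasDerivAt_id x).const_mul (-2)).div_const γbar).exp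
    have hln : HasDerivAt (fun x : ℝ => Real.log (1 + x)) (1 / (1 + x)) x :=
      ((hasDerivAt_id x).const_add 1).log hx1.ne'
    have hsplit : Real.exp (-2 * x / γbar) =
        Real.exp (2 / γbar) * Real.exp (-(2 * (1 + x) / γbar)) := by
      rw [← Real.exp_add]
      ring_nf
    refine (((((hE.const_sub (E1 (2 / γbar))).const_mul (Real.exp (2 / γbar))).sub
      (hexp.mul hln)).div_const (2 * Real.log 2))).congr_deriv ?_
    rw [hsplit]
    field_simp
    ring
  · refine ContinuousOn.intervalIntegrable ?_
    have : ContinuousOn (fun x : ℝ => Real.log (1 + x)) (Set.uIcc 0 τ) :=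
      ContinuousOn.log (by fun_prop) fun x hx => (hpos x hx).ne'
    fun_prop
end

section
/- Fix γ̄ > 0, ε̄ > 0 and ν ≥ 0. Let γ₁, γ₂ be i.i.d. random variables with density (2/γ̄)e^{−2x/γ̄} on (0,∞) and ε₁, ε₂ i.i.d. exponential with mean ε̄, all four mutually independent. Define the selected index s = 1 if γ₁ − γ₂ > ν(ε₂ − ε₁) and s = 2 otherwise (the boundary event has probability zero for ν > 0). Then the average harvested energy satisfies E[ε_s] = (ε̄/2)·[3 − γ̄²/(γ̄ + 2νε̄)²]. (Equation (40) in Appendix C: the average energy transfer of the weighted difference relay selection scheme as a function of ν.) -/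
open MeasureTheory ProbabilityTheory Real

/-- The joint law of `(γ₁, γ₂, ε₁, ε₂)`: `γ₁, γ₂` are i.i.d. with density
`(2/γ̄)e^{-2x/γ̄}` on `(0,∞)` (exponential with rate `2/γ̄`), `ε₁, ε₂` are i.i.d.
exponential with mean `ε̄` (rate `1/ε̄`), and all four are mutually independent.
A sample point `ω` has `ω.1 = γ₁`, `ω.2.1 = γ₂`, `ω.2.2.1 = ε₁`, `ω.2.2.2 = ε₂`. -/
noncomputable def wdMeasure (γbar εbar : ℝ) : Measure (ℝ × ℝ × ℝ × ℝ) :=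
  (expMeasure (2 / γbar)).prod
    ((expMeasure (2 / γbar)).prod ((expMeasure (1 / εbar)).prod (expMeasure (1 / εbar))))

namespace ExpMeasure

theorem eq_withDensity_Ioi (r : ℝ) : expMeasure r =
    (volume.restrict (Set.Ioi 0)).withDensity (fun x => ENNReal.ofReal (r * exp (-(r * x)))) := by
  rw [expMeasure, gammaMeasure, ← withDensity_indicator measurableSet_Ioi]
  refine withDensity_congr_ae ?_
  have h0 : ∀ᵐ x : ℝ, x ≠ 0 := by simp [ae_iff]
  filter_upwards [h0] with x hx
  rcases lt_or_gt_of_ne hx with h | h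
  · simp [gammaPDF, gammaPDFReal, h.le, not_le.2 h]
  · simp [gammaPDF, gammaPDFReal, h.le, h]

theorem absolutelyContinuous_restrict_Ioi (r : ℝ) :
    expMeasure r ≪ volume.restrict (Set.Ioi 0) := by
  rw [eq_withDensity_Ioi]
  exact withDensity_absolutelyContinuous _ _

theorem ae_pos (r : ℝ) : ∀ᵐ x ∂expMeasure r, 0 < x :=
  (absolutelyContinuous_restrict_Ioi r).ae_le (ae_restrict_mem measurableSet_Ioi)

theorem ae_ne (r a : ℝ) : ∀ᵐ x ∂expMeasure r, x ≠ a :=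
  ((absolutelyContinuous_restrict_Ioi r).trans Measure.restrict_le_self.absolutelyContinuous).ae_le
    (Measure.ae_ne volume a)

theorem ae_prod_sub_ne (r t : ℝ) :
    ∀ᵐ p ∂(expMeasure r).prod (expMeasure r), p.1 - p.2 ≠ t := by
  have : SFinite (expMeasure r) := by
    rw [eq_withDensity_Ioi]
    infer_instance
  have hm : MeasurableSet {p : ℝ × ℝ | p.1 - p.2 ≠ t} :=
    (measurableSet_eq_fun (by fun_prop) measurable_const).compl
  refine (Measure.ae_prod_iff_ae_ae hm).2 (.of_forall fun x => ?_)
  filter_upwards [ae_ne r (x - t)] with y hy h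
  exact hy (by linarith)

theorem integral_eq {r : ℝ} (hr : 0 < r) (f : ℝ → ℝ) :
    ∫ x, f x ∂expMeasure r = ∫ x in Set.Ioi 0, r * exp (-(r * x)) * f x := by
  rw [eq_withDensity_Ioi, integral_withDensity_eq_integral_toReal_smul (by fun_prop) (by simp)]
  refine integral_congr_ae (.of_forall fun x => ?_)
  simp only [smul_eq_mul]
  rw [ENNReal.toReal_ofReal (by positivity)]

theorem integral_exp_neg_mul {r c : ℝ} (hr : 0 < r) (hc : 0 ≤ c) :
    ∫ x, exp (-(c * x)) ∂expMeasure r = r / (r + c) := by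
  have h := integral_rpow_mul_exp_neg_mul_Ioi one_pos (show 0 < r + c by positivity)
  simp only [sub_self, rpow_zero, one_mul, rpow_one, Gamma_one, mul_one] at h
  rw [integral_eq hr, div_eq_mul_one_div, ← h, ← integral_const_mul]
  refine integral_congr_ae (.of_forall fun x => ?_)
  simp only
  rw [mul_assoc, ← exp_add]
  ring_nf

theorem integral_mul_exp_neg_mul {r c : ℝ} (hr : 0 < r) (hc : 0 ≤ c) :
    ∫ x, x * exp (-(c * x)) ∂expMeasure r = r / (r + c) ^ 2 := by
  have h := integral_rpow_mul_exp_neg_mul_Ioi two_pos (show 0 < r + c by positivity)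
  have h1 : (2 : ℝ) - 1 = 1 := by norm_num
  simp only [h1, rpow_one, Gamma_two, mul_one, rpow_two] at h
  rw [integral_eq hr, div_eq_mul_one_div, ← one_div_pow, ← h, ← integral_const_mul]
  refine integral_congr_ae (.of_forall fun x => ?_)
  simp only
  rw [show -((r + c) * x) = -(r * x) + -(c * x) by ring, exp_add]
  ring

theorem integrable_mul_exp_neg_mul {r c : ℝ} (hr : 0 < r) (hc : 0 ≤ c) :
    Integrable (fun x => x * exp (-(c * x))) (expMeasure r) :=
  not_imp_comm.1 integral_undef
    (by rw [integral_mul_exp_neg_mul hr hc]; positivity)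

theorem integrable_exp_neg_mul {r c : ℝ} (hr : 0 < r) (hc : 0 ≤ c) :
    Integrable (fun x => exp (-(c * x))) (expMeasure r) :=
  not_imp_comm.1 integral_undef
    (by rw [integral_exp_neg_mul hr hc]; positivity)

theorem integrable_id {r : ℝ} (hr : 0 < r) : Integrable (fun x => x) (expMeasure r) := by
  simpa using integrable_mul_exp_neg_mul hr le_rfl

theorem integral_id {r : ℝ} (hr : 0 < r) : ∫ x, x ∂expMeasure r = 1 / r := by
  have h := integral_mul_exp_neg_mul hr le_rfl
  simp only [zero_mul, neg_zero, exp_zero, mul_one, add_zero] at h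
  rw [h]
  field_simp

/-- The memoryless property of the exponential law. -/
theorem integral_ite_lt {r y : ℝ} (hr : 0 < r) (hy : 0 ≤ y) (f : ℝ → ℝ) :
    ∫ x, (if y < x then f x else 0) ∂expMeasure r
      = exp (-(r * y)) * ∫ z, f (y + z) ∂expMeasure r := by
  rw [integral_eq hr, integral_eq hr, ← integral_indicator measurableSet_Ioi,
    ← integral_indicator measurableSet_Ioi, ← integral_const_mul,
    ← integral_add_left_eq_self _ y]
  refine integral_congr_ae (.of_forall fun x => ?_)
  by_cases hx : 0 < x
  · have : 0 < y + x := by linarith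
    simp only [Set.indicator, Set.mem_Ioi, this, hx, if_true, lt_add_iff_pos_right]
    rw [show -(r * (y + x)) = -(r * y) + -(r * x) by ring, exp_add]
    ring
  · simp [Set.indicator, hx]

theorem integral_ite_lt_const {r t : ℝ} (hr : 0 < r) (ht : 0 ≤ t) (a b : ℝ) :
    ∫ x, (if t < x then a else b) ∂expMeasure r = b + (a - b) * exp (-(r * t)) := by
  have := isProbabilityMeasure_expMeasure hr
  have h := integral_ite_lt hr ht (fun _ => a - b)
  have hm : Measurable fun x : ℝ => if t < x then a - b else 0 :=
    Measurable.ite measurableSet_Ioi measurable_const measurable_const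
  have hi : Integrable (fun x : ℝ => if t < x then a - b else 0) (expMeasure r) :=
    .of_bound hm.aestronglyMeasurable |a - b| (.of_forall fun x => by split_ifs <;> simp)
  have e : ∀ x : ℝ, (if t < x then a else b) = b + if t < x then a - b else 0 := by
    intro x; split_ifs <;> ring
  simp only [e]
  rw [integral_add (integrable_const _) hi, h]
  simp
  ring

theorem integral_prod_ite_lt {r : ℝ} (hr : 0 < r) {g : ℝ × ℝ → ℝ}
    (hg : Integrable g ((expMeasure r).prod (expMeasure r))) :
    ∫ p, (if p.2 < p.1 then g p else 0) ∂(expMeasure r).prod (expMeasure r)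
      = ∫ y, ∫ z, exp (-(r * y)) * g (y + z, y) ∂expMeasure r ∂expMeasure r := by
  have := isProbabilityMeasure_expMeasure hr
  have hi : Integrable (fun p : ℝ × ℝ => if p.2 < p.1 then g p else 0)
      ((expMeasure r).prod (expMeasure r)) :=
    hg.indicator (measurableSet_lt measurable_snd measurable_fst)
  rw [integral_prod_symm _ hi]
  refine integral_congr_ae ?_
  filter_upwards [ae_pos r] with y hy
  rw [integral_ite_lt hr hy.le (fun x => g (x, y)), integral_const_mul]

/-- An expectation over two i.i.d. exponential variables, in terms of their minimum and the
excess of the larger over the smaller. -/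
theorem integral_prod_eq_min_excess {r : ℝ} (hr : 0 < r) {g : ℝ × ℝ → ℝ}
    (hg : Integrable g ((expMeasure r).prod (expMeasure r))) :
    ∫ p, g p ∂(expMeasure r).prod (expMeasure r)
      = (∫ y, ∫ z, exp (-(r * y)) * g (y + z, y) ∂expMeasure r ∂expMeasure r)
        + ∫ y, ∫ z, exp (-(r * y)) * g (y, y + z) ∂expMeasure r ∂expMeasure r := by
  have := isProbabilityMeasure_expMeasure hr
  have h1 := integral_prod_ite_lt hr hg
  have h2 := integral_prod_ite_lt hr hg.swap
  simp only [Function.comp, Prod.swap] at h2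
  have h3 := integral_prod_swap (μ := expMeasure r) (ν := expMeasure r)
    (fun p : ℝ × ℝ => if p.1 < p.2 then g p else 0)
  simp only [Prod.swap] at h3
  rw [← h1, ← h2, h3]
  refine Eq.trans (integral_congr_ae ?_)
    (integral_add (hg.indicator (measurableSet_lt measurable_snd measurable_fst))
      (hg.indicator (measurableSet_lt measurable_fst measurable_snd)))
  filter_upwards [ae_prod_sub_ne r 0] with p hp
  rcases lt_or_gt_of_ne (sub_ne_zero.1 hp) with h | h <;> simp [h, h.not_gt]

/-- The integral of a two-valued function of the difference of two i.i.d. exponential variables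
with a nonnegative threshold. -/
theorem integral_prod_ite_lt_sub_of_nonneg {r t : ℝ} (hr : 0 < r) (ht : 0 ≤ t) (a b : ℝ) :
    ∫ p : ℝ × ℝ, (if t < p.1 - p.2 then a else b) ∂(expMeasure r).prod (expMeasure r)
      = b + (a - b) * exp (-(r * t)) / 2 := by
  have := isProbabilityMeasure_expMeasure hr
  have hm : Measurable fun p : ℝ × ℝ => if t < p.1 - p.2 then a else b :=
    Measurable.ite (measurableSet_lt measurable_const (by fun_prop)) measurable_const
      measurable_const
  have hi : Integrable (fun p : ℝ × ℝ => if t < p.1 - p.2 then a else b)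
      ((expMeasure r).prod (expMeasure r)) :=
    .of_bound hm.aestronglyMeasurable (|a| + |b|) (.of_forall fun p => by
      split_ifs <;> simp)
  have h2 : ∀ y : ℝ, ∫ z, (if t < y - (y + z) then a else b) ∂expMeasure r = b := by
    intro y
    rw [integral_congr_ae (g := fun _ => b)]
    · simp
    · filter_upwards [ae_pos r] with z hz
      rw [if_neg (by linarith)]
  rw [integral_prod_eq_min_excess hr hi]
  simp only [integral_const_mul, h2, add_sub_cancel_left, integral_ite_lt_const hr ht,
    integral_mul_const, integral_exp_neg_mul hr hr.le]
  field_simp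
  ring

theorem integral_prod_ite_lt_sub_of_nonpos {r t : ℝ} (hr : 0 < r) (ht : t ≤ 0) (a b : ℝ) :
    ∫ p : ℝ × ℝ, (if t < p.1 - p.2 then a else b) ∂(expMeasure r).prod (expMeasure r)
      = a + (b - a) * exp (r * t) / 2 := by
  have := isProbabilityMeasure_expMeasure hr
  have h := integral_prod_ite_lt_sub_of_nonneg hr (neg_nonneg.2 ht) b a
  rw [← integral_prod_swap] at h
  simp only [Prod.fst_swap, Prod.snd_swap, mul_neg, neg_neg] at h
  rw [← h]
  refine integral_congr_ae ?_
  filter_upwards [ae_prod_sub_ne r t] with p hp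
  rcases lt_or_gt_of_ne hp with h | h
  · rw [if_neg h.not_gt, if_pos (by linarith)]
  · rw [if_pos h, if_neg (by linarith)]

end ExpMeasure

/-- Equation (40) in Appendix C: the average harvested energy `E[ε_s]` of the weighted
difference scheme (select relay 1 iff `γ₁ - γ₂ > ν(ε₂ - ε₁)`) equals
`(ε̄/2)[3 - γ̄²/(γ̄ + 2νε̄)²]`. -/
theorem weightedDifference_energy (γbar εbar ν : ℝ) (hγ : 0 < γbar) (hε : 0 < εbar)
    (hν : 0 ≤ ν) :
    (∫ ω, (if ν * (ω.2.2.2 - ω.2.2.1) < ω.1 - ω.2.1 then ω.2.2.1 else ω.2.2.2)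
        ∂(wdMeasure γbar εbar))
      = (εbar / 2) * (3 - γbar ^ 2 / (γbar + 2 * ν * εbar) ^ 2) := by
  have ha : 0 < 2 / γbar := by positivity
  have hr : 0 < 1 / εbar := by positivity
  set a := 2 / γbar with ha_def
  set r := 1 / εbar with hr_def
  have := isProbabilityMeasure_expMeasure ha
  have := isProbabilityMeasure_expMeasure hr
  set f : ℝ × ℝ × ℝ × ℝ → ℝ := fun ω =>
    if ν * (ω.2.2.2 - ω.2.2.1) < ω.1 - ω.2.1 then ω.2.2.1 else ω.2.2.2 with hf_def
  have hs : MeasurableSet {ω : ℝ × ℝ × ℝ × ℝ | ν * (ω.2.2.2 - ω.2.2.1) < ω.1 - ω.2.1} :=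
    measurableSet_lt (by fun_prop) (by fun_prop)
  have hf : Integrable f (wdMeasure γbar εbar) := by
    have h1 : Integrable (fun ω : ℝ × ℝ × ℝ × ℝ => ω.2.2.1) (wdMeasure γbar εbar) :=
      (((ExpMeasure.integrable_id hr).comp_fst (expMeasure r)).comp_snd (expMeasure a)).comp_snd
        (expMeasure a)
    have h2 : Integrable (fun ω : ℝ × ℝ × ℝ × ℝ => ω.2.2.2) (wdMeasure γbar εbar) :=
      (((ExpMeasure.integrable_id hr).comp_snd (expMeasure r)).comp_snd (expMeasure a)).comp_snd
        (expMeasure a)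
    classical
    have := Integrable.piecewise hs h1.integrableOn h2.integrableOn
    exact this.congr (.of_forall fun ω => by simp [Set.piecewise, hf_def])
  have hassoc := measurePreserving_prodAssoc (expMeasure a) (expMeasure a)
    ((expMeasure r).prod (expMeasure r))
  have hf' : Integrable (fun q => f (MeasurableEquiv.prodAssoc q))
      (((expMeasure a).prod (expMeasure a)).prod ((expMeasure r).prod (expMeasure r))) :=
    hassoc.integrable_comp_of_integrable hf
  have hsum : ∀ y, ∫ z, exp (-(r * y)) * (y + z - z * exp (-(a * ν * z)) / 2) ∂expMeasure r
      = y * exp (-(r * y)) + (1 / r - r / (r + a * ν) ^ 2 / 2) * exp (-(r * y)) := by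
    intro y
    have hi := (ExpMeasure.integrable_mul_exp_neg_mul hr (show 0 ≤ a * ν by positivity)).div_const 2
    have hid := ExpMeasure.integrable_id hr
    have hadd : Integrable (fun z => y + z) (expMeasure r) := (integrable_const y).add hid
    rw [integral_const_mul, integral_sub hadd hi,
      integral_add (integrable_const y) hid, integral_div, ExpMeasure.integral_id hr,
      ExpMeasure.integral_mul_exp_neg_mul hr (by positivity)]
    simp
    ring
  have h1 : ∀ᵐ y ∂expMeasure r,
      ∫ z, exp (-(r * y)) * (∫ p, f (MeasurableEquiv.prodAssoc (p, y + z, y))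
        ∂(expMeasure a).prod (expMeasure a)) ∂expMeasure r
      = y * exp (-(r * y)) + (1 / r - r / (r + a * ν) ^ 2 / 2) * exp (-(r * y)) := by
    refine .of_forall fun y => ?_
    rw [← hsum]
    refine integral_congr_ae ?_
    filter_upwards [ExpMeasure.ae_pos r] with z hz
    have h := ExpMeasure.integral_prod_ite_lt_sub_of_nonpos ha
      (show ν * (y - (y + z)) ≤ 0 by nlinarith) (y + z) y
    simp only [hf_def, MeasurableEquiv.prodAssoc, MeasurableEquiv.coe_mk, Equiv.prodAssoc_apply]
    rw [h]
    ring_nf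
  have h2 : ∀ᵐ y ∂expMeasure r,
      ∫ z, exp (-(r * y)) * (∫ p, f (MeasurableEquiv.prodAssoc (p, y, y + z))
        ∂(expMeasure a).prod (expMeasure a)) ∂expMeasure r
      = y * exp (-(r * y)) + (1 / r - r / (r + a * ν) ^ 2 / 2) * exp (-(r * y)) := by
    refine .of_forall fun y => ?_
    rw [← hsum]
    refine integral_congr_ae ?_
    filter_upwards [ExpMeasure.ae_pos r] with z hz
    have h := ExpMeasure.integral_prod_ite_lt_sub_of_nonneg ha
      (show 0 ≤ ν * (y + z - y) by nlinarith) y (y + z)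
    simp only [hf_def, MeasurableEquiv.prodAssoc, MeasurableEquiv.coe_mk, Equiv.prodAssoc_apply]
    rw [h]
    ring_nf
  rw [wdMeasure, ← hassoc.integral_comp' f, integral_prod_symm _ hf',
    ExpMeasure.integral_prod_eq_min_excess hr hf'.integral_prod_right,
    integral_congr_ae h1, integral_congr_ae h2,
    integral_add (ExpMeasure.integrable_mul_exp_neg_mul hr hr.le)
      ((ExpMeasure.integrable_exp_neg_mul hr hr.le).const_mul _),
    integral_const_mul, ExpMeasure.integral_mul_exp_neg_mul hr hr.le,
    ExpMeasure.integral_exp_neg_mul hr hr.le, hr_def, ha_def]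
  have hd : 0 < γbar + 2 * ν * εbar := by positivity
  have he : 1 / εbar + 2 / γbar * ν = (γbar + 2 * ν * εbar) / (εbar * γbar) := by
    field_simp
  rw [he]
  field_simp
  ring
end

section
/- Fix γ̄ > 0, ε̄ > 0 and ν > 0 with 2νε̄ ≠ γ̄. Let γ₁, γ₂ be i.i.d. with density (2/γ̄)e^{−2x/γ̄} on (0,∞) and ε₁, ε₂ i.i.d. exponential with mean ε̄, all four mutually independent, and let s = 1 if γ₁ − γ₂ > ν(ε₂ − ε₁) and s = 2 otherwise. Then the ergodic capacity satisfies E[(1/2)log₂(1+γ_s)] = [ 2(γ̄² − 4ν²ε̄²)·E₁(2/γ̄) + 4 e^{1/(νε̄)} ν² ε̄² · E₁(2/γ̄ + 1/(νε̄)) − e^{2/γ̄} γ̄² E₁(4/γ̄) ] / ( 2 e^{−2/γ̄} (γ̄² − 4ν²ε̄²) ln 2 ). (Equation (43) in Appendix C: the ergodic capacity of the weighted difference scheme as a function of ν.) -/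
open MeasureTheory ProbabilityTheory Real

section

open Set Filter Topology

lemma expMeasure_eq_restrict_withDensity (r : ℝ) :
    expMeasure r = (volume.restrict (Ioi 0)).withDensity
      (fun x => ((r * exp (-(r * x))).toNNReal : ENNReal)) := by
  have h : gammaPDF 1 r =ᵐ[volume] (Ioi (0 : ℝ)).indicator
      (fun x => ((r * exp (-(r * x))).toNNReal : ENNReal)) := by
    filter_upwards [Measure.ae_ne volume (0 : ℝ)] with x hx
    rcases hx.lt_or_gt with h | h
    · rw [gammaPDF_of_neg h, indicator_of_notMem (by simpa using h.le)]
    · rw [gammaPDF_of_nonneg h.le, indicator_of_mem (by simpa using h)]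
      simp [ENNReal.ofReal]
  rw [expMeasure, gammaMeasure, withDensity_congr_ae h, withDensity_indicator measurableSet_Ioi]

lemma integral_expMeasure {r : ℝ} (hr : 0 < r) (g : ℝ → ℝ) :
    ∫ x, g x ∂expMeasure r = ∫ x in Ioi 0, r * exp (-(r * x)) * g x := by
  rw [expMeasure_eq_restrict_withDensity, integral_withDensity_eq_integral_smul (by fun_prop)]
  refine integral_congr_ae (ae_of_all _ fun x => ?_)
  simp [NNReal.smul_def, Real.coe_toNNReal _ (mul_pos hr (exp_pos _)).le]

lemma integrable_expMeasure_iff {r : ℝ} (hr : 0 < r) (g : ℝ → ℝ) :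
    Integrable g (expMeasure r) ↔ IntegrableOn (fun x => r * exp (-(r * x)) * g x) (Ioi 0) := by
  rw [expMeasure_eq_restrict_withDensity, integrable_withDensity_iff_integrable_smul (by fun_prop)]
  refine integrable_congr (ae_of_all _ fun x => ?_)
  simp [NNReal.smul_def, Real.coe_toNNReal _ (mul_pos hr (exp_pos _)).le]

lemma ae_pos_expMeasure (r : ℝ) : ∀ᵐ x ∂expMeasure r, 0 < x := by
  rw [expMeasure_eq_restrict_withDensity]
  exact (withDensity_absolutelyContinuous _ _).ae_le (ae_restrict_mem measurableSet_Ioi)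

lemma nullSingletonClass_expMeasure (r : ℝ) : NullSingletonClass (expMeasure r) := by
  rw [expMeasure, gammaMeasure]
  exact ⟨fun x => withDensity_absolutelyContinuous _ _ (measure_singleton x)⟩

lemma integrable_exp_neg_mul_expMeasure {r c : ℝ} (hr : 0 < r) (hc : 0 < r + c) :
    Integrable (fun x => exp (-(c * x))) (expMeasure r) := by
  rw [integrable_expMeasure_iff hr]
  refine ((integrableOn_exp_mul_Ioi (neg_lt_zero.2 hc) 0).const_mul r).congr
    (ae_of_all _ fun x => ?_)
  simp only [mul_assoc, ← Real.exp_add]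
  ring_nf

lemma integral_exp_neg_mul_expMeasure {r c : ℝ} (hr : 0 < r) (hc : 0 < r + c) :
    ∫ x, exp (-(c * x)) ∂expMeasure r = r / (r + c) := by
  have h : ∀ x, r * exp (-(r * x)) * exp (-(c * x)) = r * exp (-(r + c) * x) := fun x => by
    rw [mul_assoc, ← Real.exp_add]
    ring_nf
  simp_rw [integral_expMeasure hr, h]
  rw [integral_const_mul, integral_exp_mul_Ioi (neg_lt_zero.2 hc)]
  rw [mul_zero, Real.exp_zero, neg_div_neg_eq, mul_one_div]

lemma integrableOn_log_one_add_mul_exp {s : ℝ} (hs : 0 < s) :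
    IntegrableOn (fun x => log (1 + x) * (s * exp (-(s * x)))) (Ioi 0) := by
  have h := integrableOn_rpow_mul_exp_neg_mul_rpow (p := 1) (s := 1) (b := s)
    (by norm_num) one_pos hs
  refine (h.const_mul s).mono' (Measurable.aestronglyMeasurable (by fun_prop)) ?_
  filter_upwards [ae_restrict_mem measurableSet_Ioi] with x hx
  have hx' : (0 : ℝ) < x := hx
  have h1 : 0 ≤ log (1 + x) := log_nonneg (by linarith)
  have h2 : log (1 + x) ≤ x := by
    have := log_le_sub_one_of_pos (show 0 < 1 + x by linarith)
    linarith
  rw [Real.norm_of_nonneg (by positivity), rpow_one, neg_mul]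
  nlinarith [mul_le_mul_of_nonneg_right h2 (mul_pos hs (exp_pos (-(s * x)))).le]

lemma integral_log_one_add_mul_exp {s : ℝ} (hs : 0 < s) :
    ∫ x in Ioi 0, log (1 + x) * (s * exp (-(s * x))) = exp s * E1 s := by
  have hint : IntegrableOn (fun x : ℝ => (1 + x)⁻¹ * -exp (-(s * x))) (Ioi 0) := by
    refine (integrableOn_exp_mul_Ioi (neg_lt_zero.2 hs) 0).mono'
      (Measurable.aestronglyMeasurable (by fun_prop)) ?_
    filter_upwards [ae_restrict_mem measurableSet_Ioi] with x hx
    have hx' : (0 : ℝ) < x := hx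
    rw [norm_mul, norm_neg, Real.norm_of_nonneg (exp_pos _).le,
      Real.norm_of_nonneg (by positivity), neg_mul]
    exact mul_le_of_le_one_left (exp_pos _).le (inv_le_one_of_one_le₀ (by linarith))
  have hparts := integral_Ioi_mul_deriv_eq_deriv_mul (a := 0) (a' := 0) (b' := 0)
    (u := fun x => log (1 + x)) (v := fun x => -exp (-(s * x)))
    (u' := fun x => (1 + x)⁻¹) (v' := fun x => s * exp (-(s * x)))
    (fun x hx => by
      have hx' : (0 : ℝ) < x := hx
      simpa using ((hasDerivAt_id x).const_add 1).log (by simp; linarith))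
    (fun x _ => hasDerivAt_neg_exp_mul_exp)
    (integrableOn_log_one_add_mul_exp hs) hint
    (by
      have : ContinuousAt (fun x : ℝ => log (1 + x) * -exp (-(s * x))) 0 := by
        fun_prop (disch := norm_num)
      convert! this.tendsto.mono_left nhdsWithin_le_nhds using 2
      simp)
    (by
      have h0 : Tendsto (fun x : ℝ => x * exp (-(s * x))) atTop (𝓝 0) := by
        have := tendsto_rpow_mul_exp_neg_mul_atTop_nhds_zero 1 s hs
        simpa using this
      refine squeeze_zero_norm' ?_ h0
      filter_upwards [eventually_gt_atTop 0] with x hx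
      have h1 : 0 ≤ log (1 + x) := log_nonneg (by linarith)
      have h2 : log (1 + x) ≤ x := by
        have := log_le_sub_one_of_pos (show 0 < 1 + x by linarith)
        linarith
      simp only [Pi.mul_apply, norm_mul, norm_neg, Real.norm_of_nonneg h1,
        Real.norm_of_nonneg (exp_pos _).le]
      gcongr)
  rw [hparts, E1, ← integral_const_mul]
  have hshift := (measurePreserving_add_left volume (1 : ℝ)).setIntegral_preimage_emb
    (measurableEmbedding_addLeft 1) (fun y => exp s * (exp (-s * y) / y)) (Ioi 1)
  rw [← hshift, sub_self, zero_sub, ← integral_neg]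
  have : (fun x : ℝ => 1 + x) ⁻¹' Ioi 1 = Ioi 0 := by ext; simp
  rw [this]
  refine integral_congr_ae (ae_of_all _ fun x => ?_)
  simp only [div_eq_mul_inv, ← mul_assoc, ← Real.exp_add]
  ring_nf

lemma integral_cdf_expMeasure_sub {l q ν u : ℝ} (hl : 0 < l) (hq : 0 < q) (hν : 0 < ν)
    (hne : l * ν ≠ q) (hu : 0 ≤ u) :
    ∫ b, cdf (expMeasure l) (u - ν * b) ∂expMeasure q
      = 1 - l * ν / (l * ν - q) * exp (-(q / ν * u)) + q / (l * ν - q) * exp (-(l * u)) := by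
  have hne' : l * ν - q ≠ 0 := sub_ne_zero.2 hne
  rw [integral_expMeasure hq]
  have h1 : ∀ b, b ∈ Ioi (0 : ℝ) → q * exp (-(q * b)) * cdf (expMeasure l) (u - ν * b)
      = (Iic (u / ν)).indicator
        (fun b => q * exp (-(q * b)) - q * exp (-(l * u)) * exp ((l * ν - q) * b)) b := by
    intro b _
    have hb : 0 ≤ u - ν * b ↔ b ∈ Iic (u / ν) := by
      rw [mem_Iic, le_div_iff₀ hν, sub_nonneg, mul_comm]
    rw [cdf_expMeasure_eq hl, indicator_apply]
    simp only [hb]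
    split_ifs
    · rw [mul_sub, mul_one, mul_assoc, mul_assoc, ← Real.exp_add, ← Real.exp_add]
      ring_nf
    · simp
  rw [setIntegral_congr_fun measurableSet_Ioi h1, setIntegral_indicator measurableSet_Iic,
    Ioi_inter_Iic, ← intervalIntegral.integral_of_le (by positivity),
    intervalIntegral.integral_eq_sub_of_hasDerivAt
      (f := fun b => -exp (-(q * b)) - q * exp (-(l * u)) / (l * ν - q) * exp ((l * ν - q) * b))]
  · have e1 : -(q * (u / ν)) = -(q / ν * u) := by ring
    have e2 : exp ((l * ν - q) * (u / ν)) = exp (l * u) * exp (-(q / ν * u)) := by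
      rw [← Real.exp_add]
      congr 1
      field_simp
      ring
    have e3 : exp (-(l * u)) * exp (l * u) = 1 := by
      rw [← Real.exp_add]; simp
    simp only [e1, e2, mul_zero, neg_zero, Real.exp_zero, mul_one]
    generalize exp (-(q / ν * u)) = A
    generalize exp (-(l * u)) = B at e3 ⊢
    generalize exp (l * u) = C at e3 ⊢
    field_simp
    linear_combination (-q * A) * e3
  · intro b _
    refine hasDerivAt_neg_exp_mul_exp.sub ?_
    have := (((hasDerivAt_id b).const_mul (l * ν - q)).exp).const_mul
      (q * exp (-(l * u)) / (l * ν - q))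
    convert! this using 1
    simp only [id_eq, mul_one]
    field_simp
  · exact Continuous.intervalIntegrable (by fun_prop) _ _

lemma integral_prod_cdf_expMeasure {l q ν x : ℝ} (hl : 0 < l) (hq : 0 < q) (hν : 0 < ν)
    (hne : l * ν ≠ q) (hx : 0 ≤ x) :
    ∫ p : ℝ × ℝ, cdf (expMeasure l) (x + ν * (p.1 - p.2))
        ∂(expMeasure q).prod (expMeasure q)
      = 1 - l * ν / (2 * (l * ν - q)) * exp (-(q / ν * x))
        + q ^ 2 / ((l * ν) ^ 2 - q ^ 2) * exp (-(l * x)) := by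
  have := isProbabilityMeasure_expMeasure hq
  have hne' : l * ν - q ≠ 0 := sub_ne_zero.2 hne
  have hmeas : Measurable (cdf (expMeasure l)) := (monotone_cdf _).measurable
  have hint : Integrable (fun p : ℝ × ℝ => cdf (expMeasure l) (x + ν * (p.1 - p.2)))
      ((expMeasure q).prod (expMeasure q)) := by
    refine Integrable.of_bound (Measurable.aestronglyMeasurable (by fun_prop)) 1
      (ae_of_all _ fun p => ?_)
    rw [Real.norm_of_nonneg (cdf_nonneg _ _)]
    exact cdf_le_one _ _
  have hinner : ∀ᵐ a ∂expMeasure q, ∫ b, cdf (expMeasure l) (x + ν * (a - b)) ∂expMeasure q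
      = 1 - l * ν / (l * ν - q) * exp (-(q / ν * x)) * exp (-(q * a))
        + q / (l * ν - q) * exp (-(l * x)) * exp (-(l * ν * a)) := by
    filter_upwards [ae_pos_expMeasure q] with a ha
    have h := integral_cdf_expMeasure_sub hl hq hν hne (u := x + ν * a) (by positivity)
    simp_rw [mul_sub, ← add_sub_assoc, h, mul_assoc, ← Real.exp_add]
    congr 4
    · field_simp
      ring
    · ring
  have i1 := integrable_exp_neg_mul_expMeasure hq (c := q) (by positivity)
  have i2 := integrable_exp_neg_mul_expMeasure hq (c := l * ν) (by positivity)
  rw [integral_prod _ hint, integral_congr_ae hinner, integral_add, integral_sub,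
    integral_const_mul, integral_const_mul, integral_exp_neg_mul_expMeasure hq (by positivity),
    integral_exp_neg_mul_expMeasure hq (by positivity)]
  · have h3 : l * ν + q ≠ 0 := by positivity
    have h5 : q + l * ν ≠ 0 := by positivity
    simp only [integral_const, probReal_univ, smul_eq_mul, mul_one, sq_sub_sq]
    field_simp
    ring
  · exact integrable_const _
  · exact i1.const_mul _
  · exact (integrable_const _).sub (i1.const_mul _)
  · exact i2.const_mul _

lemma measureReal_prod_fst_le {β : Type*} [MeasurableSpace β] (P : Measure ℝ)
    [IsProbabilityMeasure P] (Q : Measure β) [IsProbabilityMeasure Q] {h : β → ℝ}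
    (hh : Measurable h) :
    (P.prod Q).real {z | z.1 ≤ h z.2} = ∫ p, cdf P (h p) ∂Q := by
  rw [measureReal_def, Measure.prod_apply_symm (measurableSet_le (by fun_prop) (by fun_prop)),
    ← integral_toReal]
  · refine integral_congr_ae (ae_of_all _ fun p => ?_)
    simp only [cdf_eq_real, measureReal_def]
    rfl
  · exact (measurable_measure_prodMk_right
      (measurableSet_le (by fun_prop) (by fun_prop))).aemeasurable
  · exact ae_of_all _ fun p => measure_lt_top _ _

lemma measureReal_prod_fst_lt {β : Type*} [MeasurableSpace β] (P : Measure ℝ)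
    [IsProbabilityMeasure P] [NullSingletonClass P] (Q : Measure β) [IsProbabilityMeasure Q]
    {h : β → ℝ} (hh : Measurable h) :
    (P.prod Q).real {z | z.1 < h z.2} = ∫ p, cdf P (h p) ∂Q := by
  rw [measureReal_def, Measure.prod_apply_symm (measurableSet_lt (by fun_prop) (by fun_prop)),
    ← integral_toReal]
  · refine integral_congr_ae (ae_of_all _ fun p => ?_)
    simp only [cdf_eq_real, measureReal_def, ← measure_congr (Iio_ae_eq_Iic (μ := P))]
    rfl
  · exact (measurable_measure_prodMk_right
      (measurableSet_lt (by fun_prop) (by fun_prop))).aemeasurable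
  · exact ae_of_all _ fun p => measure_lt_top _ _

lemma integral_prod_indicator_fst {α β : Type*} [MeasurableSpace α] [MeasurableSpace β]
    (P : Measure α) [IsProbabilityMeasure P] (Q : Measure β) [IsProbabilityMeasure Q]
    {f : α → ℝ} (hf : Integrable f P) {s : Set (α × β)} (hs : MeasurableSet s) :
    ∫ z, s.indicator (fun z => f z.1) z ∂P.prod Q
      = ∫ x, f x * Q.real (Prod.mk x ⁻¹' s) ∂P := by
  rw [integral_prod _ ((hf.comp_fst Q).indicator hs)]
  refine integral_congr_ae (ae_of_all _ fun x => ?_)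
  have : (fun y => s.indicator (fun z : α × β => f z.1) (x, y))
      = (Prod.mk x ⁻¹' s).indicator fun _ => f x := by
    rfl
  dsimp only
  rw [this, integral_indicator_const _ (measurable_prodMk_left hs), smul_eq_mul, mul_comm]

lemma measurePreserving_swap_pairs {α β : Type*} [MeasurableSpace α] [MeasurableSpace β]
    (P : Measure α) [SFinite P] (Q : Measure β) [SFinite Q] :
    MeasurePreserving (fun ω : α × α × β × β => (ω.2.1, ω.1, ω.2.2.2, ω.2.2.1))
      (P.prod (P.prod (Q.prod Q))) (P.prod (P.prod (Q.prod Q))) := by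
  have h := (measurePreserving_prodAssoc P P (Q.prod Q)).comp
    (((Measure.measurePreserving_swap (μ := P) (ν := P)).prod
      (Measure.measurePreserving_swap (μ := Q) (ν := Q))).comp
      ((measurePreserving_prodAssoc P P (Q.prod Q)).symm _))
  exact h

lemma integral_ite_symmetric_selection {α β : Type*} [MeasurableSpace α] [MeasurableSpace β]
    (P : Measure α) [IsProbabilityMeasure P] (Q : Measure β) [IsProbabilityMeasure Q]
    {f : α → ℝ} (hf : Integrable f P) {s : Set (α × α × β × β)} (hs : MeasurableSet s) :
    ∫ ω, s.indicator (fun ω => f ω.1) ω + sᶜ.indicator (fun ω => f ω.2.1) ω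
        ∂P.prod (P.prod (Q.prod Q))
      = ∫ x, f x * ((P.prod (Q.prod Q)).real (Prod.mk x ⁻¹' s)
          + (P.prod (Q.prod Q)).real {z | (z.1, x, z.2.2, z.2.1) ∉ s}) ∂P := by
  have hswap := measurePreserving_swap_pairs P Q
  have hs' : MeasurableSet
      ((fun ω : α × α × β × β => (ω.2.1, ω.1, ω.2.2.2, ω.2.2.1)) ⁻¹' sᶜ) :=
    hswap.measurable hs.compl
  have hint2 : Integrable (sᶜ.indicator fun ω => f ω.2.1) (P.prod (P.prod (Q.prod Q))) :=
    ((hf.comp_fst (Q.prod Q)).comp_snd P).indicator hs.compl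
  have hmeas : ∀ t : Set (α × α × β × β), MeasurableSet t →
      Integrable (fun x => f x * (P.prod (Q.prod Q)).real (Prod.mk x ⁻¹' t)) P := fun t ht =>
    hf.mul_bdd (c := 1) (measurable_measure_prodMk_left ht).ennreal_toReal.aestronglyMeasurable
      (ae_of_all _ fun x => by
        rw [Real.norm_of_nonneg measureReal_nonneg]
        exact measureReal_le_one)
  rw [integral_add ((hf.comp_fst _).indicator hs) hint2, integral_prod_indicator_fst P _ hf hs]
  have h2 : ∫ ω, sᶜ.indicator (fun ω => f ω.2.1) ω ∂P.prod (P.prod (Q.prod Q))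
      = ∫ x, f x * (P.prod (Q.prod Q)).real {z | (z.1, x, z.2.2, z.2.1) ∉ s} ∂P := by
    rw [← hswap.map_eq, integral_map hswap.aemeasurable
      (hswap.map_eq.symm ▸ hint2.aestronglyMeasurable)]
    exact integral_prod_indicator_fst P _ hf hs'
  rw [h2]
  simp only [mul_add]
  exact (integral_add (hmeas s hs) (hmeas _ hs')).symm

lemma integral_log_one_add_mul_exp_expMeasure {l c : ℝ} (hl : 0 < l) (hc : 0 < l + c) :
    Integrable (fun x => log (1 + x) * exp (-(c * x))) (expMeasure l) ∧
      ∫ x, log (1 + x) * exp (-(c * x)) ∂expMeasure l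
        = l / (l + c) * (exp (l + c) * E1 (l + c)) := by
  have h : (fun x => l * exp (-(l * x)) * (log (1 + x) * exp (-(c * x))))
      = fun x => l / (l + c) * (log (1 + x) * ((l + c) * exp (-((l + c) * x)))) := by
    ext x
    rw [show -((l + c) * x) = -(l * x) + -(c * x) by ring, Real.exp_add]
    field_simp
  rw [integrable_expMeasure_iff hl, integral_expMeasure hl, h, integral_const_mul,
    integral_log_one_add_mul_exp hc]
  exact ⟨(integrableOn_log_one_add_mul_exp hc).const_mul _, rfl⟩

theorem integral_log_weightedDifference {l q ν : ℝ} (hl : 0 < l) (hq : 0 < q) (hν : 0 < ν)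
    (hne : l * ν ≠ q) :
    ∫ ω : ℝ × ℝ × ℝ × ℝ,
        log (1 + (if ν * (ω.2.2.2 - ω.2.2.1) < ω.1 - ω.2.1 then ω.1 else ω.2.1))
        ∂(expMeasure l).prod ((expMeasure l).prod ((expMeasure q).prod (expMeasure q)))
      = 2 * (exp l * E1 l)
        - (l * ν) ^ 2 / ((l * ν) ^ 2 - q ^ 2) * (exp (l + q / ν) * E1 (l + q / ν))
        + q ^ 2 / ((l * ν) ^ 2 - q ^ 2) * (exp (l + l) * E1 (l + l)) := by
  have := isProbabilityMeasure_expMeasure hl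
  have := isProbabilityMeasure_expMeasure hq
  have := nullSingletonClass_expMeasure l
  obtain ⟨i0, e0⟩ := integral_log_one_add_mul_exp_expMeasure hl (c := 0) (by simpa)
  obtain ⟨i1, e1⟩ := integral_log_one_add_mul_exp_expMeasure hl (c := q / ν) (by positivity)
  obtain ⟨i2, e2⟩ := integral_log_one_add_mul_exp_expMeasure hl (c := l) (by positivity)
  simp only [zero_mul, neg_zero, Real.exp_zero, mul_one, add_zero] at i0 e0
  have hs : MeasurableSet {ω : ℝ × ℝ × ℝ × ℝ | ν * (ω.2.2.2 - ω.2.2.1) < ω.1 - ω.2.1} :=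
    measurableSet_lt (by fun_prop) (by fun_prop)
  have hsplit := integral_ite_symmetric_selection (expMeasure l) (expMeasure q) i0 hs
  have hinner : ∀ᵐ x ∂expMeasure l, log (1 + x)
      * (((expMeasure l).prod ((expMeasure q).prod (expMeasure q))).real
          (Prod.mk x ⁻¹' {ω : ℝ × ℝ × ℝ × ℝ | ν * (ω.2.2.2 - ω.2.2.1) < ω.1 - ω.2.1})
        + ((expMeasure l).prod ((expMeasure q).prod (expMeasure q))).real
          {z | (z.1, x, z.2.2, z.2.1) ∉
            {ω : ℝ × ℝ × ℝ × ℝ | ν * (ω.2.2.2 - ω.2.2.1) < ω.1 - ω.2.1}})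
      = 2 * log (1 + x)
        - l * ν / (l * ν - q) * (log (1 + x) * exp (-(q / ν * x)))
        + 2 * q ^ 2 / ((l * ν) ^ 2 - q ^ 2) * (log (1 + x) * exp (-(l * x))) := by
    filter_upwards [ae_pos_expMeasure l] with x hx
    have hlt : (Prod.mk x ⁻¹' {ω : ℝ × ℝ × ℝ × ℝ | ν * (ω.2.2.2 - ω.2.2.1) < ω.1 - ω.2.1})
        = {z | z.1 < x + ν * (z.2.1 - z.2.2)} := by
      ext z
      simp only [mem_preimage, mem_ofPred_eq]
      constructor <;> intro h <;> linarith
    have hle : {z : ℝ × ℝ × ℝ | ¬ν * (z.2.1 - z.2.2) < z.1 - x}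
        = {z | z.1 ≤ x + ν * (z.2.1 - z.2.2)} := by
      ext z
      simp only [mem_ofPred_eq, not_lt]
      constructor <;> intro h <;> linarith
    rw [hlt, hle,
      measureReal_prod_fst_le _ _ (h := fun p : ℝ × ℝ => x + ν * (p.1 - p.2)) (by fun_prop),
      measureReal_prod_fst_lt _ _ (h := fun p : ℝ × ℝ => x + ν * (p.1 - p.2)) (by fun_prop),
      integral_prod_cdf_expMeasure hl hq hν hne hx.le]
    have h2 : l * ν / (2 * (l * ν - q)) = l * ν / (l * ν - q) / 2 := by
      rw [div_div, mul_comm 2]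
    rw [h2]
    ring
  have i01 := (i0.const_mul 2).sub (i1.const_mul (l * ν / (l * ν - q)))
  rw [integral_congr_ae hinner, integral_add (by exact i01) (i2.const_mul _), integral_sub (i0.const_mul _) (i1.const_mul _), integral_const_mul,
    integral_const_mul, integral_const_mul, e0, e1, e2] at hsplit
  have hpt : ∀ ω : ℝ × ℝ × ℝ × ℝ,
      log (1 + (if ν * (ω.2.2.2 - ω.2.2.1) < ω.1 - ω.2.1 then ω.1 else ω.2.1))
      = {ω : ℝ × ℝ × ℝ × ℝ | ν * (ω.2.2.2 - ω.2.2.1) < ω.1 - ω.2.1}.indicator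
          (fun ω => log (1 + ω.1)) ω
        + {ω : ℝ × ℝ × ℝ × ℝ | ν * (ω.2.2.2 - ω.2.2.1) < ω.1 - ω.2.1}ᶜ.indicator
          (fun ω => log (1 + ω.2.1)) ω := by
    intro ω
    by_cases h : ν * (ω.2.2.2 - ω.2.2.1) < ω.1 - ω.2.1 <;> simp [h]
  simp_rw [hpt]
  rw [hsplit]
  have h3 : l * ν + q ≠ 0 := by positivity
  have hne' : l * ν - q ≠ 0 := sub_ne_zero.2 hne
  rw [sq_sub_sq]
  generalize exp (l + q / ν) * E1 (l + q / ν) = X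
  field_simp
  ring

end

/-- Equation (43) in Appendix C: the ergodic capacity `E[(1/2) log₂(1+γ_s)]` of the
weighted difference scheme (select relay 1 iff `γ₁ - γ₂ > ν(ε₂ - ε₁)`) as a function
of the weight `ν`. -/
theorem weightedDifference_capacity (γbar εbar ν : ℝ) (hγ : 0 < γbar) (hε : 0 < εbar)
    (hν : 0 < ν) (hne : 2 * ν * εbar ≠ γbar) :
    (∫ ω, (1 / 2) *
        (Real.log (1 + (if ν * (ω.2.2.2 - ω.2.2.1) < ω.1 - ω.2.1 then ω.1 else ω.2.1))
          / Real.log 2) ∂(wdMeasure γbar εbar))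
      = (2 * (γbar ^ 2 - 4 * ν ^ 2 * εbar ^ 2) * E1 (2 / γbar)
          + 4 * Real.exp (1 / (ν * εbar)) * ν ^ 2 * εbar ^ 2 *
              E1 (2 / γbar + 1 / (ν * εbar))
          - Real.exp (2 / γbar) * γbar ^ 2 * E1 (4 / γbar))
        / (2 * Real.exp (-2 / γbar) * (γbar ^ 2 - 4 * ν ^ 2 * εbar ^ 2) * Real.log 2) := by
  rw [wdMeasure]
  have hne2 : 2 / γbar * ν ≠ 1 / εbar := by
    intro h
    field_simp at h
    exact hne h
  rw [integral_const_mul, integral_div, integral_log_weightedDifference (by positivity)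
    (by positivity) hν hne2]
  have hlog : log 2 ≠ 0 := (log_pos one_lt_two).ne'
  have hd : γbar ^ 2 - 4 * ν ^ 2 * εbar ^ 2 ≠ 0 := by
    rw [show γbar ^ 2 - 4 * ν ^ 2 * εbar ^ 2
      = (γbar + 2 * ν * εbar) * (γbar - 2 * ν * εbar) by ring]
    exact mul_ne_zero (by positivity) (sub_ne_zero.2 hne.symm)
  have hc1 : (2 / γbar * ν) ^ 2 / ((2 / γbar * ν) ^ 2 - (1 / εbar) ^ 2)
      = -(4 * ν ^ 2 * εbar ^ 2) / (γbar ^ 2 - 4 * ν ^ 2 * εbar ^ 2) := by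
    rw [show (2 / γbar * ν) ^ 2 - (1 / εbar) ^ 2
      = -(γbar ^ 2 - 4 * ν ^ 2 * εbar ^ 2) / (γbar ^ 2 * εbar ^ 2) by field_simp; ring]
    field_simp
    ring
  have hc2 : (1 / εbar) ^ 2 / ((2 / γbar * ν) ^ 2 - (1 / εbar) ^ 2)
      = -γbar ^ 2 / (γbar ^ 2 - 4 * ν ^ 2 * εbar ^ 2) := by
    rw [show (2 / γbar * ν) ^ 2 - (1 / εbar) ^ 2
      = -(γbar ^ 2 - 4 * ν ^ 2 * εbar ^ 2) / (γbar ^ 2 * εbar ^ 2) by field_simp; ring]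
    field_simp
  rw [hc1, hc2, show 1 / εbar / ν = 1 / (ν * εbar) by rw [div_div, mul_comm],
    show E1 (2 / γbar + 2 / γbar) = E1 (4 / γbar) by congr 1; ring, Real.exp_add, Real.exp_add,
    show -2 / γbar = -(2 / γbar) by ring, Real.exp_neg]
  have hA : exp (2 / γbar) ≠ 0 := (exp_pos _).ne'
  generalize exp (2 / γbar) = A at hA ⊢
  generalize exp (1 / (ν * εbar)) = B
  generalize E1 (2 / γbar + 1 / (ν * εbar)) = X
  generalize E1 (2 / γbar) = Y
  generalize E1 (4 / γbar) = Z
  field_simp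
  ring
end

section
/- Fix γ̄ > 0, ε̄ > 0, an integer N ≥ 1, an outage threshold γ_th > 0 and a selection threshold τ > 0. Let γ₁,…,γ_N be i.i.d. with density (2/γ̄)e^{−2x/γ̄}, ε₁,…,ε_N i.i.d. exponential with mean ε̄, all mutually independent; let κ = argmax γ_i, λ = argmax ε_i (a.s. unique), and s = κ if γ_κ ≥ τ, s = λ otherwise. Then the outage probability satisfies: P(γ_s < γ_th) = (1 − e^{−2γ_th/γ̄})^N if τ ≤ γ_th, and P(γ_s < γ_th) = (1 − e^{−2γ_th/γ̄})·(1 − e^{−2τ/γ̄})^{N−1} if τ > γ_th. (Equation (25): the outage probability of the threshold-checking relay selection scheme.) -/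
open MeasureTheory ProbabilityTheory Real

/-- The joint law of `(γ₁,…,γ_N, ε₁,…,ε_N)`: the `γ_i` are i.i.d. with density
`(2/γ̄)e^{-2x/γ̄}` (exponential with rate `2/γ̄`), the `ε_i` are i.i.d. exponential with
mean `ε̄` (rate `1/ε̄`), and all `2N` variables are mutually independent.
A sample point `ω` has `ω.1 i = γ_i` and `ω.2 i = ε_i`. -/
noncomputable def relayMeasure (γbar εbar : ℝ) (N : ℕ) :
    Measure ((Fin N → ℝ) × (Fin N → ℝ)) :=
  (Measure.pi fun _ => expMeasure (2 / γbar)).prod (Measure.pi fun _ => expMeasure (1 / εbar))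

instance nullSingletonClass_expMeasure_s13 (r : ℝ) : NullSingletonClass (expMeasure r) where
  measure_singleton x := by
    have h : expMeasure r ≪ volume := withDensity_absolutelyContinuous _ _
    exact h (measure_singleton x)

theorem expMeasure_Iio {r x : ℝ} (hr : 0 < r) (hx : 0 ≤ x) :
    expMeasure r (Set.Iio x) = ENNReal.ofReal (1 - Real.exp (-(r * x))) := by
  have := isProbabilityMeasure_expMeasure hr
  rw [measure_congr Iio_ae_eq_Iic, ← ofReal_cdf, cdf_expMeasure_eq hr, if_pos hx]

/-- Distinct coordinates of an i.i.d. sample from an atomless law almost surely differ. -/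
theorem ae_pi_coord_ne {ι : Type*} [Fintype ι] (μ : Measure ℝ) [IsProbabilityMeasure μ]
    [NullSingletonClass μ] {i j : ι} (hij : i ≠ j) :
    ∀ᵐ x ∂(Measure.pi fun _ : ι => μ), x i ≠ x j := by
  have hind : IndepFun (fun x : ι → ℝ => x i) (fun x => x j) (Measure.pi fun _ : ι => μ) :=
    (iIndepFun_pi (μ := fun _ : ι => μ) (X := fun _ => id) fun _ => aemeasurable_id).indepFun hij
  have hmap := (indepFun_iff_map_prod_eq_prod_map_map (measurable_pi_apply i).aemeasurable
    (measurable_pi_apply j).aemeasurable).1 hind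
  have heval (k : ι) : (Measure.pi fun _ : ι => μ).map (fun x => x k) = μ :=
    (measurePreserving_eval (fun _ : ι => μ) k).map_eq
  rw [heval, heval] at hmap
  have hdiag : ∀ᵐ p ∂(μ.prod μ), p.1 ≠ p.2 := by
    have hmeas : MeasurableSet {p : ℝ × ℝ | p.1 = p.2} :=
      measurableSet_eq_fun measurable_fst measurable_snd
    rw [ae_iff]
    simp only [ne_eq, not_not]
    rw [Measure.measure_prod_null hmeas]
    refine Filter.Eventually.of_forall fun a => ?_
    have : Prod.mk a ⁻¹' {p : ℝ × ℝ | p.1 = p.2} = {a} := by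
      ext b
      simp [eq_comm]
    simp [this]
  rw [← hmap] at hdiag
  exact ae_of_ae_map (f := fun x : ι → ℝ => (x i, x j))
    ((measurable_pi_apply i).prodMk (measurable_pi_apply j)).aemeasurable hdiag

/-- The argmax events of an i.i.d. sample from an atomless law have total mass one. -/
theorem sum_pi_strict_argmax {ι : Type*} [Fintype ι] [Nonempty ι] (μ : Measure ℝ)
    [IsProbabilityMeasure μ] [NullSingletonClass μ] :
    ∑ i, (Measure.pi fun _ : ι => μ) {x | ∀ j, j ≠ i → x j < x i} = 1 := by
  rw [← tsum_fintype (L := .unconditional ι), ← measure_iUnion]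
  · rw [prob_compl_eq_zero_iff₀ ?_ |>.symm]
    · have hne : ∀ᵐ x ∂(Measure.pi fun _ : ι => μ), ∀ i j, i ≠ j → x i ≠ x j := by
        simp only [ae_all_iff]
        exact fun i j hij => ae_pi_coord_ne μ hij
      rw [← mem_ae_iff]
      filter_upwards [hne] with x hx
      obtain ⟨i, hi⟩ := Finite.exists_max x
      exact Set.mem_iUnion.2 ⟨i, fun j hj => lt_of_le_of_ne (hi j) (hx j i hj)⟩
    · exact (MeasurableSet.iUnion fun i => by measurability).nullMeasurableSet
  · intro i k hik
    refine Set.disjoint_left.2 fun x hi hk => ?_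
    exact lt_asymm (hi k hik.symm) (hk i hik)
  · intro i
    measurability

/-- A rectangle for the first component, chosen by the argmax of an independent second
component, has the mass of the rectangle when that mass does not depend on the choice. -/
theorem prod_pi_iUnion_strict_argmax {α ι : Type*} [MeasurableSpace α] [Fintype ι] [Nonempty ι]
    (μ : Measure α) [SFinite μ] (ν : Measure ℝ) [IsProbabilityMeasure ν] [NullSingletonClass ν]
    {B : ι → Set α} (hB : ∀ i, MeasurableSet (B i)) {c : ENNReal} (hc : ∀ i, μ (B i) = c) :
    (μ.prod (Measure.pi fun _ : ι => ν)) (⋃ i, B i ×ˢ {x | ∀ j, j ≠ i → x j < x i}) = c := by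
  rw [measure_iUnion]
  · simp only [Measure.prod_prod, hc, tsum_fintype]
    rw [← Finset.mul_sum, sum_pi_strict_argmax, mul_one]
  · intro i k hik
    refine Set.disjoint_left.2 fun x hi hk => ?_
    exact lt_asymm (hi.2 k hik.symm) (hk.2 i hik)
  · intro i
    exact (hB i).prod (by measurability)

/-- Equation (25): the outage probability `P(γ_s < γ_th)` of the threshold-checking relay
selection scheme, which selects the capacity-best relay `κ` when `γ_κ ≥ τ` and the
energy-best relay `λ` otherwise. -/
theorem thresholdChecking_outage (γbar εbar τ γth : ℝ) (hγ : 0 < γbar) (hε : 0 < εbar)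
    (hτ : 0 < τ) (hγth : 0 < γth) (N : ℕ) (hN : 1 ≤ N)
    (kap lam : ((Fin N → ℝ) × (Fin N → ℝ)) → Fin N)
    (hkap : ∀ᵐ ω ∂(relayMeasure γbar εbar N), ∀ j, ω.1 j ≤ ω.1 (kap ω))
    (hlam : ∀ᵐ ω ∂(relayMeasure γbar εbar N), ∀ j, ω.2 j ≤ ω.2 (lam ω)) :
    (τ ≤ γth →
      relayMeasure γbar εbar N
          {ω | ω.1 (if τ ≤ ω.1 (kap ω) then kap ω else lam ω) < γth}
        = ENNReal.ofReal ((1 - Real.exp (-2 * γth / γbar)) ^ N))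
    ∧ (γth < τ →
      relayMeasure γbar εbar N
          {ω | ω.1 (if τ ≤ ω.1 (kap ω) then kap ω else lam ω) < γth}
        = ENNReal.ofReal ((1 - Real.exp (-2 * γth / γbar)) *
            (1 - Real.exp (-2 * τ / γbar)) ^ (N - 1))) := by
  have hr : 0 < 2 / γbar := by positivity
  have hs : 0 < 1 / εbar := by positivity
  have := isProbabilityMeasure_expMeasure hr
  have := isProbabilityMeasure_expMeasure hs
  have : Nonempty (Fin N) := ⟨⟨0, hN⟩⟩
  have hcdf {x : ℝ} (hx : 0 < x) : expMeasure (2 / γbar) (Set.Iio x)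
      = ENNReal.ofReal (1 - Real.exp (-2 * x / γbar)) := by
    rw [expMeasure_Iio hr hx.le]
    congr 3
    ring
  have hnonneg {x : ℝ} (hx : 0 < x) : 0 ≤ 1 - Real.exp (-2 * x / γbar) := by
    rw [sub_nonneg, Real.exp_le_one_iff]
    exact div_nonpos_of_nonpos_of_nonneg (by linarith) hγ.le
  constructor
  · intro hle
    have hset : {ω : (Fin N → ℝ) × (Fin N → ℝ) |
          ω.1 (if τ ≤ ω.1 (kap ω) then kap ω else lam ω) < γth}
        =ᵐ[relayMeasure γbar εbar N] (Set.univ.pi fun _ => Set.Iio γth) ×ˢ Set.univ := by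
      filter_upwards [hkap] with ω hk
      refine propext (Iff.trans (b := ∀ j, ω.1 j < γth) ?_ ?_)
      · change ω.1 (if τ ≤ ω.1 (kap ω) then kap ω else lam ω) < γth ↔ _
        refine ⟨fun h j => ?_, fun h => h _⟩
        split_ifs at h with hc
        · exact (hk j).trans_lt h
        · linarith [hk j]
      · change _ ↔ ω ∈ (Set.univ.pi fun _ => Set.Iio γth) ×ˢ Set.univ
        simp [Set.mem_prod]
    rw [measure_congr hset, relayMeasure, Measure.prod_prod, Measure.pi_pi, measure_univ, mul_one,
      Finset.prod_const, Finset.card_univ, Fintype.card_fin, hcdf hγth,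
      ENNReal.ofReal_pow (hnonneg hγth)]
  · intro hlt
    have hne : ∀ᵐ ω ∂(relayMeasure γbar εbar N), ∀ i j, i ≠ j → ω.2 i ≠ ω.2 j := by
      simp only [ae_all_iff]
      exact fun i j hij => Measure.quasiMeasurePreserving_snd.ae (ae_pi_coord_ne _ hij)
    have hset : {ω : (Fin N → ℝ) × (Fin N → ℝ) |
          ω.1 (if τ ≤ ω.1 (kap ω) then kap ω else lam ω) < γth}
        =ᵐ[relayMeasure γbar εbar N]
          ⋃ i, (Set.univ.pi fun j => Set.Iio (if j = i then γth else τ)) ×ˢ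
            {x | ∀ j, j ≠ i → x j < x i} := by
      filter_upwards [hkap, hlam, hne] with ω hk hl hn
      refine propext ?_
      change ω.1 (if τ ≤ ω.1 (kap ω) then kap ω else lam ω) < γth ↔ ω ∈ ⋃ i, _
      simp only [Set.mem_iUnion, Set.mem_prod, Set.mem_univ_pi, Set.mem_Iio, Set.mem_ofPred_eq]
      constructor
      · intro h
        split_ifs at h with hc
        · linarith
        · refine ⟨lam ω, fun j => ?_, fun j hj => lt_of_le_of_ne (hl j) (hn _ _ hj)⟩
          split_ifs with hj
          · rwa [hj]
          · exact (hk j).trans_lt (not_le.1 hc)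
      · rintro ⟨i, hB, hM⟩
        have hi : lam ω = i := by
          by_contra hne'
          exact (hM _ hne').not_ge (hl i)
        have hc : ¬ τ ≤ ω.1 (kap ω) := by
          have := hB (kap ω)
          split_ifs at this <;> linarith
        rw [if_neg hc, hi]
        simpa using hB i
    rw [measure_congr hset, relayMeasure]
    refine prod_pi_iUnion_strict_argmax _ _
      (fun i => MeasurableSet.univ_pi fun _ => measurableSet_Iio) fun i => ?_
    rw [Measure.pi_pi, ← Finset.mul_prod_erase _ _ (Finset.mem_univ i), if_pos rfl,
      Finset.prod_congr rfl fun j hj => by rw [if_neg (Finset.ne_of_mem_erase hj)]]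
    rw [Finset.prod_const, Finset.card_erase_of_mem (Finset.mem_univ i), Finset.card_univ,
      Fintype.card_fin, hcdf hγth, hcdf hτ, ENNReal.ofReal_mul (hnonneg hγth),
      ENNReal.ofReal_pow (hnonneg hτ)]
end

section
/- Fix γ_th > 0 and a tradeoff factor δ ∈ (0,1) with δ ≠ 3/4, and set k = (1−δ)^{−1/2} − 1. Define for γ̄ > 0 the weighted-difference outage probability P(γ̄) = [ e^{−4γ_th/γ̄} (e^{2γ_th/γ̄} − 1)² + k² ( e^{−2γ_th/γ̄} (2 − e^{−2γ_th/(γ̄ k)}) − 1 ) ] / (1 − k²). Then lim_{γ̄ → ∞} γ̄ · P(γ̄) = 2 γ_th (1 − √(1−δ)). (Corollaries 5 and 6 for the weighted difference scheme: its diversity order equals one for every δ > 0, with high-SNR outage probability P ≈ (2γ_th/γ̄)(1 − √(1−δ)), i.e., array gain 1/(2(1 − √(1−δ))).) -/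
open Real Filter

/-- If `F 0 = 0` and `F` has derivative `L` at `0`, then `g * F g⁻¹` tends to `L` at infinity. -/
theorem HasDerivAt.tendsto_mul_comp_inv_atTop {F : ℝ → ℝ} {L : ℝ} (hF : HasDerivAt F L 0)
    (h0 : F 0 = 0) : Tendsto (fun g : ℝ => g * F g⁻¹) atTop (nhds L) := by
  have hinv : Tendsto (fun g : ℝ => g⁻¹) atTop (nhdsWithin 0 {0}ᶜ) :=
    tendsto_inv_atTop_nhdsGT_zero.mono_right
      (nhdsWithin_mono _ fun _ hx => ne_of_gt hx)
  refine (hF.tendsto_slope_zero.comp hinv).congr fun g => ?_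
  simp [h0]

/-- The weighted-difference outage numerator, as a function of the inverse mean SNR `t`, has
derivative `2 * c * (k - k ^ 2)` at `t = 0`. -/
theorem hasDerivAt_weightedDifference_numerator (c : ℝ) {k : ℝ} (hk : k ≠ 0) :
    HasDerivAt (fun t : ℝ => Real.exp (-4 * c * t) * (Real.exp (2 * c * t) - 1) ^ 2
      + k ^ 2 * (Real.exp (-2 * c * t) * (2 - Real.exp (-2 * c / k * t)) - 1))
      (2 * c * (k - k ^ 2)) 0 := by
  have hexp (a : ℝ) : HasDerivAt (fun t : ℝ => Real.exp (a * t)) a 0 := by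
    simpa using ((hasDerivAt_id (0 : ℝ)).const_mul a).exp
  have h := ((hexp (-4 * c)).mul (((hexp (2 * c)).sub_const 1).pow 2)).add
    ((((hexp (-2 * c)).mul ((hexp (-2 * c / k)).const_sub 2)).sub_const 1).const_mul (k ^ 2))
  refine h.congr_deriv ?_
  simp
  field_simp
  ring

/-- Corollaries 5 and 6 for the weighted difference scheme: with tradeoff factor
`δ ∈ (0,1)`, `δ ≠ 3/4`, and `k = (1-δ)^{-1/2} - 1`, the outage probability
`P(γ̄)` of the weighted difference scheme satisfies
`lim_{γ̄→∞} γ̄ P(γ̄) = 2γ_th(1 - √(1-δ))`, i.e., the scheme has diversity order one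
and array gain `1/(2(1-√(1-δ)))`. -/
theorem weightedDifference_asymptotic (γth δ : ℝ) (hγth : 0 < γth)
    (hδ : δ ∈ Set.Ioo (0 : ℝ) 1) (hδ' : δ ≠ 3 / 4)
    (k : ℝ) (hk : k = (1 - δ) ^ (-(1 : ℝ) / 2) - 1)
    (P : ℝ → ℝ)
    (hP : ∀ g : ℝ, P g =
      (Real.exp (-4 * γth / g) * (Real.exp (2 * γth / g) - 1) ^ 2
          + k ^ 2 * (Real.exp (-2 * γth / g) * (2 - Real.exp (-2 * γth / (g * k))) - 1))
        / (1 - k ^ 2)) :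
    Tendsto (fun g : ℝ => g * P g) atTop (nhds (2 * γth * (1 - Real.sqrt (1 - δ)))) := by
  obtain ⟨hδ0, hδ1⟩ := hδ
  have hpos : 0 < 1 - δ := by linarith
  set s := Real.sqrt (1 - δ) with hs
  have hs0 : 0 < s := Real.sqrt_pos.2 hpos
  have hsq : s ^ 2 = 1 - δ := Real.sq_sqrt hpos.le
  have hks : k = s⁻¹ - 1 := by
    rw [hk, hs, Real.sqrt_eq_rpow, ← Real.rpow_neg hpos.le]
    norm_num
  have hs1 : s < 1 := by nlinarith
  have hk0 : 0 < k := by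
    rw [hks]
    linarith [(one_lt_inv₀ hs0).2 hs1]
  have hk1 : 1 - k ≠ 0 := by
    intro h
    have h2 : s⁻¹ = 2 := by linarith
    have h3 : s = 1 / 2 := by rw [← inv_inv s, h2]; norm_num
    exact hδ' (by rw [h3] at hsq; linarith)
  have hlim := ((hasDerivAt_weightedDifference_numerator γth hk0.ne').div_const
    (1 - k ^ 2)).tendsto_mul_comp_inv_atTop (by norm_num)
  have hL : 2 * γth * (k - k ^ 2) / (1 - k ^ 2) = 2 * γth * (1 - s) := by
    have hk2 : 1 - k ^ 2 ≠ 0 := by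
      rw [show 1 - k ^ 2 = (1 - k) * (1 + k) by ring]
      exact mul_ne_zero hk1 (by positivity)
    have hsk : s * (1 + k) = 1 := by rw [hks]; field_simp; ring
    rw [div_eq_iff hk2]
    linear_combination 2 * γth * (1 - k) * hsk
  rw [hL] at hlim
  refine hlim.congr fun g => ?_
  rw [hP, show -2 * γth / (g * k) = -2 * γth / k * g⁻¹ by field_simp]
  simp only [div_eq_mul_inv]
end

section
/- Let (Ω, P) be a probability space carrying real random variables γ₁, γ₂, ε₁, ε₂, let F : ℝ → ℝ be a nondecreasing measurable function with F(γ₁), F(γ₂), ε₁, ε₂ integrable, and let ζ > 0. Define the selection policy w* = 1 on the event {F(γ₁) − F(γ₂) ≥ ζ(ε₂ − ε₁)} and w* = 0 otherwise. Then for every measurable policy w : Ω → {0,1} satisfying the energy constraint E[w ε₁ + (1−w) ε₂] ≥ E[w* ε₁ + (1−w*) ε₂], one has E[w F(γ₁) + (1−w) F(γ₂)] ≤ E[w* F(γ₁) + (1−w*) F(γ₂)]. In particular, no selection policy can simultaneously achieve strictly larger average performance metric and at least as large average energy transfer as w*, i.e., the policy w* lies on the Pareto frontier of the tradeoff between E[F(γ_s)]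 and the average energy transfer. (Theorem 1.) -/
open MeasureTheory

/-- A mixture of two integrable functions with a measurable `{0,1}`-valued weight is integrable. -/
theorem integrable_policy_mix {Ω : Type*} [MeasurableSpace Ω] {P : Measure Ω}
    {u f g : Ω → ℝ} (hu : Measurable u) (hu01 : ∀ ω, u ω = 0 ∨ u ω = 1)
    (hf : Integrable f P) (hg : Integrable g P) :
    Integrable (fun ω => u ω * f ω + (1 - u ω) * g ω) P := by
  refine (hf.bdd_mul (c := 1) hu.aestronglyMeasurable (.of_forall fun ω => ?_)).add
    (hg.bdd_mul (c := 1) (measurable_const.sub hu).aestronglyMeasurable (.of_forall fun ω => ?_))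
  all_goals rcases hu01 ω with h | h <;> simp [h]

/-- Theorem 1: Pareto optimality of the weighted-difference-type selection policy.
On a probability space carrying the SNRs `γ₁, γ₂` and harvested energies `ε₁, ε₂`,
with `F` a nondecreasing measurable performance metric and `ζ > 0`, the policy
`w* = 1` iff `F(γ₁) - F(γ₂) ≥ ζ(ε₂ - ε₁)` maximizes the average performance
`E[w F(γ₁) + (1-w) F(γ₂)]` among all `{0,1}`-valued policies `w` whose average energy
transfer `E[w ε₁ + (1-w) ε₂]` is at least that of `w*`; hence `w*` lies on the Pareto
frontier of the performance–energy tradeoff. -/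
theorem pareto_frontier_policy {Ω : Type*} [MeasurableSpace Ω]
    (P : Measure Ω) [IsProbabilityMeasure P]
    (γ1 γ2 ε1 ε2 : Ω → ℝ)
    (hγ1 : Measurable γ1) (hγ2 : Measurable γ2)
    (hε1 : Measurable ε1) (hε2 : Measurable ε2)
    (F : ℝ → ℝ) (hFmono : Monotone F) (hFmeas : Measurable F)
    (hintF1 : Integrable (fun ω => F (γ1 ω)) P)
    (hintF2 : Integrable (fun ω => F (γ2 ω)) P)
    (hintε1 : Integrable ε1 P) (hintε2 : Integrable ε2 P)
    (ζ : ℝ) (hζ : 0 < ζ)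
    (wstar : Ω → ℝ)
    (hwstar : ∀ ω, wstar ω =
      if ζ * (ε2 ω - ε1 ω) ≤ F (γ1 ω) - F (γ2 ω) then 1 else 0)
    (w : Ω → ℝ) (hw : Measurable w) (hw01 : ∀ ω, w ω = 0 ∨ w ω = 1)
    (henergy : (∫ ω, (wstar ω * ε1 ω + (1 - wstar ω) * ε2 ω) ∂P)
      ≤ ∫ ω, (w ω * ε1 ω + (1 - w ω) * ε2 ω) ∂P) :
    (∫ ω, (w ω * F (γ1 ω) + (1 - w ω) * F (γ2 ω)) ∂P)
      ≤ ∫ ω, (wstar ω * F (γ1 ω) + (1 - wstar ω) * F (γ2 ω)) ∂P := by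
  have hws01 : ∀ ω, wstar ω = 0 ∨ wstar ω = 1 := fun ω => by
    rw [hwstar]; split_ifs <;> simp
  have hws : Measurable wstar := by
    rw [funext hwstar]
    exact Measurable.ite (measurableSet_le ((hε2.sub hε1).const_mul ζ)
      ((hFmeas.comp hγ1).sub (hFmeas.comp hγ2))) measurable_const measurable_const
  have hFw := integrable_policy_mix hw hw01 hintF1 hintF2
  have hFs := integrable_policy_mix hws hws01 hintF1 hintF2
  have hεw := integrable_policy_mix hw hw01 hintε1 hintε2
  have hεs := integrable_policy_mix hws hws01 hintε1 hintε2
  have hlagrangian := integral_mono (hFw.add (hεw.const_mul ζ)) (hFs.add (hεs.const_mul ζ))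
    fun ω => by
      simp only [Pi.add_apply, hwstar ω]
      split_ifs <;> rcases hw01 ω with h | h <;> rw [h] <;> linarith
  rw [integral_add' hFw (hεw.const_mul ζ), integral_add' hFs (hεs.const_mul ζ),
    integral_const_mul, integral_const_mul] at hlagrangian
  linarith [mul_le_mul_of_nonneg_left henergy hζ.le]
end
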